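/- arXiv:math/9508206 — 2 statements merged into one kernel-verified Lean document; each statement's English description precedes it below -/
import Mathlib

section
/- Let i ∈ I, X ∈ IPe([≤i]), and let X' ⊆ X be closed and nonempty with X'↾(<i) = X↾(<i). If X' satisfies conditions (P-2) and (P-3) for this particular i (i.e., D_{X'z}(i) is perfect for every z ∈ X'↾(<i), and {x↾(<i) : x ∈ X', x(i) ∈ G} is open in X'↾(<i) for every open G ⊆ D), then X' ∈ IPe([≤i]). -/
open Set

abbrev Cantor : Type := ℕ → Bool

section
variable {I : Type}

/-- Restriction of a point of `D^η` to `D^ξ` (for `ξ ⊆ η`). -/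
def restrictFn {ξ η : Set I} (h : ξ ⊆ η) (x : ↥η → Cantor) : ↥ξ → Cantor :=
  fun j => x ⟨j.1, h j.2⟩

/-- Projection `X↾ξ` of a set `X ⊆ D^η`. -/
def resSet {ξ η : Set I} (h : ξ ⊆ η) (X : Set (↥η → Cantor)) : Set (↥ξ → Cantor) :=
  restrictFn h '' X

/-- Inverse projection `Y↾⁻¹η` of a set `Y ⊆ D^ξ`. -/
def resPre {ξ η : Set I} (h : ξ ⊆ η) (Y : Set (↥ξ → Cantor)) : Set (↥η → Cantor) :=
  {y | restrictFn h y ∈ Y}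

/-- `A` is (relatively) open in `B`. -/
def RelOpen {α : Type*} [TopologicalSpace α] (A B : Set α) : Prop :=
  ∃ U, IsOpen U ∧ A = U ∩ B

/-- `A` is (relatively) closed in `B`. -/
def RelClosed {α : Type*} [TopologicalSpace α] (A B : Set α) : Prop :=
  ∃ U, IsClosed U ∧ A = U ∩ B

/-- `A` is (relatively) clopen in `B`. -/
def RelClopen {α : Type*} [TopologicalSpace α] (A B : Set α) : Prop :=
  RelOpen A B ∧ RelClosed A B

open Classical in
/-- The union `x ∪ y` of two partial points agreeing on the common domain. -/
noncomputable def glue {ξ η : Set I} (x : ↥ξ → Cantor) (y : ↥η → Cantor) :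
    ↥(ξ ∪ η) → Cantor :=
  fun j => if h : j.1 ∈ ξ then x ⟨j.1, h⟩
           else y ⟨j.1, ((Set.mem_union j.1 ξ η).mp j.2).resolve_left h⟩

variable [PartialOrder I]

/-- `[<i]`. -/
def seg (i : I) : Set I := {j | j < i}

/-- `[≤i]`. -/
def segLe (i : I) : Set I := {j | j ≤ i}

/-- `[≯i]`. -/
def segNG (i : I) : Set I := {j | ¬ i < j}

lemma seg_subset {ζ : Set I} (hζ : IsLowerSet ζ) {i : I} (hi : i ∈ ζ) : seg i ⊆ ζ :=
  fun _ hj => hζ (le_of_lt hj) hi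

lemma segLe_subset {ζ : Set I} (hζ : IsLowerSet ζ) {i : I} (hi : i ∈ ζ) : segLe i ⊆ ζ :=
  fun _ hj => hζ hj hi

lemma isLowerSet_segLe (i : I) : IsLowerSet (segLe i) :=
  fun _ _ hba ha => le_trans hba ha

lemma seg_subset_segLe (i : I) : seg i ⊆ segLe i :=
  fun _ hj => le_of_lt hj

lemma mem_segLe_self (i : I) : i ∈ segLe i := le_refl i

/-- `D_{Xz}(i) = {x(i) : x ∈ X, x↾(<i) = z}`. -/
def Dxz {ζ : Set I} (X : Set (↥ζ → Cantor)) {i : I} (hi : i ∈ ζ) (h : seg i ⊆ ζ)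
    (z : ↥(seg i) → Cantor) : Set Cantor :=
  {c | ∃ x ∈ X, restrictFn h x = z ∧ x ⟨i, hi⟩ = c}

/-- Pre-conditions `IPe(ζ)`. -/
def IPe (ζ : Set I) (hζ : IsLowerSet ζ) (X : Set (↥ζ → Cantor)) : Prop :=
  -- P-1
  (IsClosed X ∧ X.Nonempty) ∧
  -- P-2
  (∀ (i : I) (hi : i ∈ ζ), ∀ z ∈ resSet (seg_subset hζ hi) X,
      Perfect (Dxz X hi (seg_subset hζ hi) z)) ∧
  -- P-3
  (∀ (i : I) (hi : i ∈ ζ), ∀ G : Set Cantor, IsOpen G →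
      RelOpen
        ({z | ∃ x ∈ X, x ⟨i, hi⟩ ∈ G ∧ restrictFn (seg_subset hζ hi) x = z} :
          Set (↥(seg i) → Cantor))
        (resSet (seg_subset hζ hi) X)) ∧
  -- P-4
  (∀ ξ η : Set I, IsLowerSet ξ → IsLowerSet η → ∀ (hξ : ξ ⊆ ζ) (hη : η ⊆ ζ),
      ∀ x ∈ resSet hξ X, ∀ y ∈ resSet hη X,
        restrictFn (Set.inter_subset_left : ξ ∩ η ⊆ ξ) x =
          restrictFn (Set.inter_subset_right : ξ ∩ η ⊆ η) y →
        glue x y ∈ resSet (Set.union_subset hξ hη) X)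

/-- `stem(A)`: the length of the longest common initial segment of members of `A`. -/
noncomputable def stem (A : Set Cantor) : ℕ :=
  sInf {n | ∃ a ∈ A, ∃ b ∈ A, a n ≠ b n}

/-- `Spl(A,e)` for `A ⊆ D`. -/
def SplD (A : Set Cantor) (e : Bool) : Set Cantor :=
  {a ∈ A | a (stem A) = e}

/-- `Spl(X,i,e)` for `X ⊆ D^ζ`. -/
def Spl {ζ : Set I} (hζ : IsLowerSet ζ) (X : Set (↥ζ → Cantor)) {i : I} (hi : i ∈ ζ)
    (e : Bool) : Set (↥ζ → Cantor) :=
  {x ∈ X |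
    x ⟨i, hi⟩ ∈
      SplD (Dxz X hi (seg_subset hζ hi) (restrictFn (seg_subset hζ hi) x)) e}

/-- A `ζ`-admissible function: `Φ : ω → ζ` taking each value of `ζ` infinitely often. -/
def Admissible (ζ : Set I) (Φ : ℕ → I) : Prop :=
  (∀ n, Φ n ∈ ζ) ∧ ∀ i ∈ ζ, ∀ N : ℕ, ∃ n, N ≤ n ∧ Φ n = i

/-- The sets `X_Φ[u]` for finite binary sequences `u`. -/
def XPhi {ζ : Set I} (hζ : IsLowerSet ζ) (Φ : ℕ → I) (hΦ : ∀ n, Φ n ∈ ζ)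
    (X : Set (↥ζ → Cantor)) : (m : ℕ) → (Fin m → Bool) → Set (↥ζ → Cantor)
  | 0, _ => X
  | m + 1, u =>
      Spl hζ (XPhi hζ Φ hΦ X m (fun k => u k.castSucc)) (hΦ m) (u (Fin.last m))

/-- `X` is shrinkable: each `X_Φ[a]` is a singleton. -/
def Shrinkable {ζ : Set I} (hζ : IsLowerSet ζ) (X : Set (↥ζ → Cantor)) : Prop :=
  ∀ (Φ : ℕ → I) (hΦ : Admissible ζ Φ) (a : ℕ → Bool),
    ∃ x, (⋂ m : ℕ, XPhi hζ Φ hΦ.1 X m (fun k => a k.1)) = {x}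

/-- Conditions `Pe(ζ)`: shrinkable pre-conditions. -/
def Pe (ζ : Set I) (hζ : IsLowerSet ζ) (X : Set (↥ζ → Cantor)) : Prop :=
  IPe ζ hζ X ∧ Shrinkable hζ X

/-- `Perf = Pe(I)`. -/
def Perf (X : Set (↥(Set.univ : Set I) → Cantor)) : Prop :=
  Pe Set.univ isLowerSet_univ X

/-- The initial segments `ξ[u,v]`. -/
def xiUV (Φ : ℕ → I) : (m : ℕ) → (Fin m → Bool) → (Fin m → Bool) → Set I
  | 0, _, _ => Set.univ
  | m + 1, u, v =>
      if u (Fin.last m) = v (Fin.last m) then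
        xiUV Φ m (fun k => u k.castSucc) (fun k => v k.castSucc)
      else
        xiUV Φ m (fun k => u k.castSucc) (fun k => v k.castSucc) ∩ segNG (Φ m)

/-- A `Φ`-splitting system of order `m`. -/
def SplittingSystem (Φ : ℕ → I) (m : ℕ)
    (X : (n : ℕ) → (Fin n → Bool) → Set (↥(Set.univ : Set I) → Cantor)) : Prop :=
  (∀ n, n ≤ m → ∀ u : Fin n → Bool, Perf (X n u)) ∧
  -- S-1
  (∀ n, n < m → ∀ (u : Fin n → Bool) (e : Bool),
      X (n + 1) (Fin.snoc u e) ⊆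
        Spl isLowerSet_univ (X n u) (Set.mem_univ (Φ n)) e) ∧
  -- S-2
  (∀ n, n ≤ m → ∀ u v : Fin n → Bool,
      resSet (Set.subset_univ (xiUV Φ n u v)) (X n u) =
        resSet (Set.subset_univ (xiUV Φ n u v)) (X n v)) ∧
  -- S-3
  (∀ n, n ≤ m → ∀ u v : Fin n → Bool, ∀ i : I, i ∉ xiUV Φ n u v →
      resSet (Set.subset_univ (segLe i)) (X n u) ∩
        resSet (Set.subset_univ (segLe i)) (X n v) = ∅)

/-- `F` is reducible to `ξ` on `X`. -/
def Reducible {β : Type*} (F : (↥(Set.univ : Set I) → Cantor) → β) (ξ : Set I)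
    (X : Set (↥(Set.univ : Set I) → Cantor)) : Prop :=
  ∀ x ∈ X, ∀ y ∈ X,
    restrictFn (Set.subset_univ ξ) x = restrictFn (Set.subset_univ ξ) y → F x = F y

/-- `F` captures `i` on `X`. -/
def Captures {β : Type*} (F : (↥(Set.univ : Set I) → Cantor) → β) (i : I)
    (X : Set (↥(Set.univ : Set I) → Cantor)) : Prop :=
  ∀ x ∈ X, ∀ y ∈ X, F x = F y → x ⟨i, Set.mem_univ i⟩ = y ⟨i, Set.mem_univ i⟩

/-- Borel sets of finite level: level `0` = closed sets, level `n+1` = countable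
unions or countable intersections of sets of level `n`. -/
def BorelLevel {α : Type*} [TopologicalSpace α] : ℕ → Set (Set α)
  | 0 => {C | IsClosed C}
  | n + 1 =>
      {S | (∃ f : ℕ → Set α, (∀ k, f k ∈ BorelLevel n) ∧ S = ⋃ k, f k) ∨
           (∃ f : ℕ → Set α, (∀ k, f k ∈ BorelLevel n) ∧ S = ⋂ k, f k)}

end

lemma restrictFn_restrictFn {I : Type} {ξ η ζ : Set I} (h : ξ ⊆ η) (h' : η ⊆ ζ)
    (x : ↥ζ → Cantor) : restrictFn h (restrictFn h' x) = restrictFn (h.trans h') x := rfl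

lemma resSet_resSet {I : Type} {ξ η ζ : Set I} (h : ξ ⊆ η) (h' : η ⊆ ζ)
    (X : Set (↥ζ → Cantor)) : resSet h (resSet h' X) = resSet (h.trans h') X := by
  simp only [resSet, Set.image_image, restrictFn_restrictFn]

lemma resSet_congr {I : Type} {ξ η ζ : Set I} (h : ξ ⊆ η) (h' : η ⊆ ζ)
    {X Y : Set (↥ζ → Cantor)} (hXY : resSet h' X = resSet h' Y) :
    resSet (h.trans h') X = resSet (h.trans h') Y := by
  rw [← resSet_resSet h h', hXY, resSet_resSet]

lemma subset_seg_of_notMem {I : Type} [PartialOrder I] {i : I} {ξ : Set I}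
    (hle : ξ ⊆ segLe i) (hi : i ∉ ξ) : ξ ⊆ seg i :=
  fun _ hj => lt_of_le_of_ne (hle hj) (fun h => hi (h ▸ hj))

lemma glue_restrictFn {I : Type} {ξ η ζ : Set I} (hξ : ξ ⊆ ζ) (hη : η ⊆ ζ)
    (x : ↥ζ → Cantor) :
    glue (restrictFn hξ x) (restrictFn hη x) = restrictFn (Set.union_subset hξ hη) x := by
  funext j
  unfold glue restrictFn
  split_ifs <;> rfl

lemma restrictFn_eq_of_inter_eq {I : Type} {ξ η : Set I} (hξη : ξ ⊆ η) {x : ↥ξ → Cantor}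
    {y : ↥η → Cantor}
    (h : restrictFn (Set.inter_subset_left : ξ ∩ η ⊆ ξ) x =
      restrictFn (Set.inter_subset_right : ξ ∩ η ⊆ η) y) : x = restrictFn hξη y :=
  funext fun j => congrFun h ⟨j.1, j.2, hξη j.2⟩

lemma restrictFn_eq_of_inter_eq' {I : Type} {ξ η : Set I} (hηξ : η ⊆ ξ) {x : ↥ξ → Cantor}
    {y : ↥η → Cantor}
    (h : restrictFn (Set.inter_subset_left : ξ ∩ η ⊆ ξ) x =
      restrictFn (Set.inter_subset_right : ξ ∩ η ⊆ η) y) : restrictFn hηξ x = y :=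
  funext fun j => congrFun h ⟨j.1, hηξ j.2, j.2⟩

/-- Sets with the same projection to `η` satisfy the same existential statements about
restrictions to `η`. -/
lemma exists_mem_congr_of_resSet_eq {I : Type} {η ζ : Set I} {h : η ⊆ ζ}
    {X Y : Set (↥ζ → Cantor)} (hXY : resSet h X = resSet h Y)
    (P : (↥η → Cantor) → Prop) :
    (∃ x ∈ X, P (restrictFn h x)) ↔ ∃ x ∈ Y, P (restrictFn h x) := by
  unfold resSet at hXY
  rw [← Set.exists_mem_image (f := restrictFn h) (p := P), hXY, Set.exists_mem_image]

theorem stmt3 (I : Type) [PartialOrder I] [Countable I]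
    (i : I) (X : Set (↥(segLe i) → Cantor))
    (hX : IPe (segLe i) (isLowerSet_segLe i) X)
    (X' : Set (↥(segLe i) → Cantor)) (hsub : X' ⊆ X)
    (hclosed : IsClosed X') (hne : X'.Nonempty)
    (hres : resSet (seg_subset_segLe i) X' = resSet (seg_subset_segLe i) X)
    (hP2 : ∀ z ∈ resSet (seg_subset_segLe i) X',
      Perfect (Dxz X' (mem_segLe_self i) (seg_subset_segLe i) z))
    (hP3 : ∀ G : Set Cantor, IsOpen G →
      RelOpen
        ({z | ∃ x ∈ X', x ⟨i, mem_segLe_self i⟩ ∈ G ∧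
            restrictFn (seg_subset_segLe i) x = z} : Set (↥(seg i) → Cantor))
        (resSet (seg_subset_segLe i) X')) :
    IPe (segLe i) (isLowerSet_segLe i) X' := by
  obtain ⟨-, hX2, hX3, hX4⟩ := hX
  have hseg : ∀ {j : I}, j < i → seg j ⊆ seg i := fun h _ hk => lt_trans hk h
  refine ⟨⟨hclosed, hne⟩, ?_, ?_, ?_⟩
  · intro j hj z hz
    by_cases hji : j = i
    · subst hji; exact hP2 z hz
    replace hji : j < i := lt_of_le_of_ne hj hji
    have hD : Dxz X' hj (seg_subset (isLowerSet_segLe i) hj) z =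
        Dxz X hj (seg_subset (isLowerSet_segLe i) hj) z :=
      Set.ext fun c => exists_mem_congr_of_resSet_eq hres
        fun w => restrictFn (hseg hji) w = z ∧ w ⟨j, hji⟩ = c
    rw [hD]
    rw [resSet_congr (hseg hji) _ hres] at hz
    exact hX2 j hj z hz
  · intro j hj G hG
    by_cases hji : j = i
    · subst hji; exact hP3 G hG
    replace hji : j < i := lt_of_le_of_ne hj hji
    rw [resSet_congr (hseg hji) _ hres]
    convert hX3 j hj G hG using 1
    exact Set.ext fun z => exists_mem_congr_of_resSet_eq hres
      fun w => w ⟨j, hji⟩ ∈ G ∧ restrictFn (hseg hji) w = z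
  · intro ξ η hξl hηl hξ hη x hx y hy hxy
    by_cases hiξ : i ∈ ξ
    · have hηξ : η ⊆ ξ := hη.trans (segLe_subset hξl hiξ)
      obtain ⟨w, hw, rfl⟩ := hx
      rw [← restrictFn_eq_of_inter_eq' hηξ hxy, restrictFn_restrictFn, glue_restrictFn]
      exact Set.mem_image_of_mem _ hw
    by_cases hiη : i ∈ η
    · have hξη : ξ ⊆ η := hξ.trans (segLe_subset hηl hiη)
      obtain ⟨w, hw, rfl⟩ := hy
      rw [restrictFn_eq_of_inter_eq hξη hxy, restrictFn_restrictFn, glue_restrictFn]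
      exact Set.mem_image_of_mem _ hw
    rw [resSet_congr (Set.union_subset (subset_seg_of_notMem hξ hiξ)
      (subset_seg_of_notMem hη hiη)) _ hres]
    exact hX4 ξ η hξl hηl hξ hη x (Set.image_mono hsub hx) y (Set.image_mono hsub hy) hxy
end

section
/- Suppose ξ, ζ are initial segments of I with ξ ⊆ ζ, X ∈ Pe(ζ), Y ∈ Pe(ξ), and Y ⊆ X↾ξ. Then Z = X ∩ (Y↾⁻¹ζ) belongs to Pe(ζ). -/
open Set

section
variable {I : Type}

/-- Two points of `D^ζ` agree on the coordinates in `η`. -/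
def Agree {ζ : Set I} (η : Set I) (x y : ↥ζ → Cantor) : Prop :=
  ∀ j : ↥ζ, j.1 ∈ η → x j = y j

namespace Agree
variable {ζ η θ : Set I} {x y z : ↥ζ → Cantor}

lemma refl (η : Set I) (x : ↥ζ → Cantor) : Agree η x x := fun _ _ => rfl

lemma symm (h : Agree η x y) : Agree η y x := fun j hj => (h j hj).symm

lemma trans (h : Agree η x y) (h' : Agree η y z) : Agree η x z :=
  fun j hj => (h j hj).trans (h' j hj)

lemma mono (h : Agree η x y) (hθ : θ ⊆ η) : Agree θ x y := fun j hj => h j (hθ hj)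

end Agree

lemma restrictFn_eq_iff {ξ ζ : Set I} (h : ξ ⊆ ζ) {x y : ↥ζ → Cantor} :
    restrictFn h x = restrictFn h y ↔ Agree ξ x y :=
  ⟨fun e j hj => congrFun e ⟨j.1, hj⟩, fun e => funext fun j => e ⟨j.1, h j.2⟩ j.2⟩

lemma continuous_restrictFn {ξ ζ : Set I} (h : ξ ⊆ ζ) :
    Continuous (restrictFn h : (↥ζ → Cantor) → ↥ξ → Cantor) :=
  continuous_pi fun _ => continuous_apply _

lemma restrictFn_eq_glue_iff {ζ ξ η : Set I} (hξ : ξ ⊆ ζ) (hη : η ⊆ ζ) {x y w : ↥ζ → Cantor}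
    (hxy : Agree (ξ ∩ η) x y) :
    restrictFn (Set.union_subset hξ hη) w = glue (restrictFn hξ x) (restrictFn hη y) ↔
      Agree ξ w x ∧ Agree η w y := by
  constructor
  · intro h
    refine ⟨fun j hj => ?_, fun j hj => ?_⟩
    · have := congrFun h ⟨j.1, Or.inl hj⟩
      simpa [restrictFn, glue, hj] using this
    · have := congrFun h ⟨j.1, Or.inr hj⟩
      by_cases hjξ : j.1 ∈ ξ
      · rw [← hxy j ⟨hjξ, hj⟩]
        simpa [restrictFn, glue, hjξ] using this
      · simpa [restrictFn, glue, hjξ] using this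
  · rintro ⟨h₁, h₂⟩
    funext j
    by_cases hjξ : j.1 ∈ ξ
    · simpa [restrictFn, glue, hjξ] using h₁ ⟨j.1, hξ hjξ⟩ hjξ
    · have hjη : j.1 ∈ η := j.2.resolve_left hjξ
      simpa [restrictFn, glue, hjξ] using h₂ ⟨j.1, hη hjη⟩ hjη

lemma resSet_inter_resPre {ζ ξ : Set I} (hsub : ξ ⊆ ζ) {X : Set (↥ζ → Cantor)}
    {Y : Set (↥ξ → Cantor)} (hYsub : Y ⊆ resSet hsub X) :
    resSet hsub (X ∩ resPre hsub Y) = Y := by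
  refine Set.Subset.antisymm ?_ fun y hy => ?_
  · rintro _ ⟨x, hx, rfl⟩
    exact hx.2
  · obtain ⟨x, hx, rfl⟩ := hYsub hy
    exact ⟨x, ⟨hx, hy⟩, rfl⟩

lemma mem_resPre_of_agree {ζ ξ : Set I} (hsub : ξ ⊆ ζ) {Y : Set (↥ξ → Cantor)}
    {x y : ↥ζ → Cantor} (hy : y ∈ resPre hsub Y) (hxy : Agree ξ x y) : x ∈ resPre hsub Y := by
  have : restrictFn hsub y ∈ Y := hy
  rwa [← (restrictFn_eq_iff hsub).2 hxy] at this

variable [PartialOrder I]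

/-- The fiber `D_{Xz}(i)` for `z = x↾(<i)`. -/
def fiber {ζ : Set I} (hζ : IsLowerSet ζ) (X : Set (↥ζ → Cantor)) {i : I} (hi : i ∈ ζ)
    (x : ↥ζ → Cantor) : Set Cantor :=
  Dxz X hi (seg_subset hζ hi) (restrictFn (seg_subset hζ hi) x)

lemma mem_fiber {ζ : Set I} {hζ : IsLowerSet ζ} {X : Set (↥ζ → Cantor)} {i : I} {hi : i ∈ ζ}
    {x : ↥ζ → Cantor} {c : Cantor} :
    c ∈ fiber hζ X hi x ↔ ∃ y ∈ X, Agree (seg i) y x ∧ y ⟨i, hi⟩ = c := by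
  simp only [fiber, Dxz, Set.mem_ofPred_eq, restrictFn_eq_iff]

lemma fiber_congr {ζ : Set I} (hζ : IsLowerSet ζ) (X : Set (↥ζ → Cantor)) {i : I} (hi : i ∈ ζ)
    {x y : ↥ζ → Cantor} (h : Agree (seg i) x y) : fiber hζ X hi x = fiber hζ X hi y := by
  rw [fiber, (restrictFn_eq_iff _).2 h, fiber]

lemma self_mem_fiber {ζ : Set I} (hζ : IsLowerSet ζ) {X : Set (↥ζ → Cantor)} {i : I} (hi : i ∈ ζ)
    {x : ↥ζ → Cantor} (hx : x ∈ X) : x ⟨i, hi⟩ ∈ fiber hζ X hi x :=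
  mem_fiber.2 ⟨x, hx, Agree.refl _ _, rfl⟩

lemma mem_Spl {ζ : Set I} {hζ : IsLowerSet ζ} {X : Set (↥ζ → Cantor)} {i : I} {hi : i ∈ ζ}
    {e : Bool} {x : ↥ζ → Cantor} :
    x ∈ Spl hζ X hi e ↔ x ∈ X ∧ x ⟨i, hi⟩ (stem (fiber hζ X hi x)) = e :=
  ⟨fun h => ⟨h.1, h.2.2⟩, fun h => ⟨h.1, self_mem_fiber hζ hi h.1, h.2⟩⟩

/-- On `X`, the property `P` is an open condition on `x↾(<i)`. -/
def SegOpen {ζ : Set I} (hζ : IsLowerSet ζ) (X : Set (↥ζ → Cantor)) {i : I} (hi : i ∈ ζ)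
    (P : (↥ζ → Cantor) → Prop) : Prop :=
  ∃ U, IsOpen U ∧ ∀ x ∈ X, P x ↔ restrictFn (seg_subset hζ hi) x ∈ U

namespace SegOpen
variable {ζ : Set I} {hζ : IsLowerSet ζ} {X : Set (↥ζ → Cantor)} {i : I} {hi : i ∈ ζ}

lemma congr {P Q : (↥ζ → Cantor) → Prop} (h : SegOpen hζ X hi P) (hPQ : ∀ x ∈ X, Q x ↔ P x) :
    SegOpen hζ X hi Q := by
  obtain ⟨U, hU, hP⟩ := h
  exact ⟨U, hU, fun x hx => (hPQ x hx).trans (hP x hx)⟩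

lemma and {P Q : (↥ζ → Cantor) → Prop} (hP : SegOpen hζ X hi P) (hQ : SegOpen hζ X hi Q) :
    SegOpen hζ X hi (fun x => P x ∧ Q x) := by
  obtain ⟨U, hU, hP⟩ := hP
  obtain ⟨V, hV, hQ⟩ := hQ
  exact ⟨U ∩ V, hU.inter hV, fun x hx => and_congr (hP x hx) (hQ x hx)⟩

lemma exists' {ι : Type} {P : ι → (↥ζ → Cantor) → Prop} (hP : ∀ k, SegOpen hζ X hi (P k)) :
    SegOpen hζ X hi (fun x => ∃ k, P k x) := by
  choose U hU hP using hP
  refine ⟨⋃ k, U k, isOpen_iUnion hU, fun x hx => ?_⟩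
  simp only [Set.mem_iUnion, hP _ x hx]

lemma forall_lt {P : ℕ → (↥ζ → Cantor) → Prop} (hP : ∀ k, SegOpen hζ X hi (P k)) (n : ℕ) :
    SegOpen hζ X hi (fun x => ∀ k < n, P k x) := by
  choose U hU hP using hP
  refine ⟨⋂ k ∈ Set.Iio n, U k, (Set.finite_Iio n).isOpen_biInter fun k _ => hU k,
    fun x hx => ?_⟩
  simp only [Set.mem_iInter, Set.mem_Iio, hP _ x hx]

end SegOpen

/-- Condition (P-4) in terms of points of `X`. -/
def Amalgamates {ζ : Set I} (X : Set (↥ζ → Cantor)) : Prop :=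
  ∀ ξ η : Set I, IsLowerSet ξ → IsLowerSet η → ∀ x ∈ X, ∀ y ∈ X, Agree (ξ ∩ η) x y →
    ∃ w ∈ X, Agree ξ w x ∧ Agree η w y

lemma amalgamates_iff {ζ : Set I} (hζ : IsLowerSet ζ) (X : Set (↥ζ → Cantor)) :
    (∀ ξ η : Set I, IsLowerSet ξ → IsLowerSet η → ∀ (hξ : ξ ⊆ ζ) (hη : η ⊆ ζ),
      ∀ x ∈ resSet hξ X, ∀ y ∈ resSet hη X,
        restrictFn (Set.inter_subset_left : ξ ∩ η ⊆ ξ) x =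
          restrictFn (Set.inter_subset_right : ξ ∩ η ⊆ η) y →
        glue x y ∈ resSet (Set.union_subset hξ hη) X) ↔ Amalgamates X := by
  constructor
  · intro h ξ η hξ hη x hx y hy hxy
    have hxy' : Agree (ξ ∩ ζ ∩ (η ∩ ζ)) x y := hxy.mono fun _ hj => ⟨hj.1.1, hj.2.1⟩
    obtain ⟨w, hw, hwe⟩ := h (ξ ∩ ζ) (η ∩ ζ) (hξ.inter hζ) (hη.inter hζ)
      Set.inter_subset_right Set.inter_subset_right _ ⟨x, hx, rfl⟩ _ ⟨y, hy, rfl⟩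
      (funext fun j => hxy' ⟨j.1, j.2.1.2⟩ j.2)
    rw [restrictFn_eq_glue_iff _ _ hxy'] at hwe
    exact ⟨w, hw, fun j hj => hwe.1 j ⟨hj, j.2⟩, fun j hj => hwe.2 j ⟨hj, j.2⟩⟩
  · rintro h ξ η hξ hη hξζ hηζ _ ⟨x, hx, rfl⟩ _ ⟨y, hy, rfl⟩ hxy
    have hxy' : Agree (ξ ∩ η) x y := fun j hj => congrFun hxy ⟨j.1, hj⟩
    obtain ⟨w, hw, hwe⟩ := h ξ η hξ hη x hx y hy hxy'
    exact ⟨w, hw, (restrictFn_eq_glue_iff _ _ hxy').2 hwe⟩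

lemma segOpen_fiber_iff {ζ : Set I} (hζ : IsLowerSet ζ) (X : Set (↥ζ → Cantor)) {i : I}
    (hi : i ∈ ζ) (G : Set Cantor) :
    RelOpen ({z | ∃ x ∈ X, x ⟨i, hi⟩ ∈ G ∧ restrictFn (seg_subset hζ hi) x = z} :
        Set (↥(seg i) → Cantor)) (resSet (seg_subset hζ hi) X) ↔
      SegOpen hζ X hi fun x => (fiber hζ X hi x ∩ G).Nonempty := by
  have key : ∀ x, (fiber hζ X hi x ∩ G).Nonempty ↔ restrictFn (seg_subset hζ hi) x ∈
      ({z | ∃ x ∈ X, x ⟨i, hi⟩ ∈ G ∧ restrictFn (seg_subset hζ hi) x = z} :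
        Set (↥(seg i) → Cantor)) := by
    intro x
    constructor
    · rintro ⟨_, ⟨y, hy, hyx, rfl⟩, hG⟩
      exact ⟨y, hy, hG, hyx⟩
    · rintro ⟨y, hy, hG, hyx⟩
      exact ⟨_, ⟨y, hy, hyx, rfl⟩, hG⟩
  refine exists_congr fun U => and_congr_right fun _ => ⟨fun h x hx => ?_, fun h => ?_⟩
  · refine (key x).trans ?_
    rw [h]
    exact ⟨fun h => h.1, fun h => ⟨h, x, hx, rfl⟩⟩
  · ext z
    constructor
    · rintro ⟨x, hx, hG, rfl⟩
      exact ⟨(h x hx).1 ((key x).2 ⟨x, hx, hG, rfl⟩), x, hx, rfl⟩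
    · rintro ⟨hz, x, hx, rfl⟩
      exact (key x).1 ((h x hx).2 hz)

lemma ipe_iff {ζ : Set I} (hζ : IsLowerSet ζ) (X : Set (↥ζ → Cantor)) :
    IPe ζ hζ X ↔ (IsClosed X ∧ X.Nonempty) ∧
      (∀ (i : I) (hi : i ∈ ζ), ∀ x ∈ X, Perfect (fiber hζ X hi x)) ∧
      (∀ (i : I) (hi : i ∈ ζ) (G : Set Cantor), IsOpen G →
        SegOpen hζ X hi fun x => (fiber hζ X hi x ∩ G).Nonempty) ∧
      Amalgamates X := by
  refine and_congr Iff.rfl (and_congr ?_ (and_congr ?_ (amalgamates_iff hζ X)))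
  · simp only [resSet, Set.forall_mem_image, fiber]
  · exact forall_congr' fun i => forall_congr' fun hi => forall_congr' fun G =>
      imp_congr_right fun _ => segOpen_fiber_iff hζ X hi G

namespace IPe
variable {ζ : Set I} {hζ : IsLowerSet ζ} {X : Set (↥ζ → Cantor)}

lemma isClosed (h : IPe ζ hζ X) : IsClosed X := h.1.1

lemma perfect_fiber (h : IPe ζ hζ X) {i : I} (hi : i ∈ ζ) {x : ↥ζ → Cantor} (hx : x ∈ X) :
    Perfect (fiber hζ X hi x) := ((ipe_iff hζ X).1 h).2.1 i hi x hx

lemma segOpen (h : IPe ζ hζ X) {i : I} (hi : i ∈ ζ) {G : Set Cantor} (hG : IsOpen G) :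
    SegOpen hζ X hi fun x => (fiber hζ X hi x ∩ G).Nonempty :=
  ((ipe_iff hζ X).1 h).2.2.1 i hi G hG

lemma amalgamates (h : IPe ζ hζ X) : Amalgamates X := ((ipe_iff hζ X).1 h).2.2.2

end IPe

lemma Perfect.exists_ne_apply {A : Set Cantor} (hA : Perfect A) (hne : A.Nonempty) :
    ∃ n, ∃ a ∈ A, ∃ b ∈ A, a n ≠ b n := by
  obtain ⟨a, ha⟩ := hne
  obtain ⟨b, hb, hba⟩ := accPt_iff_nhds.1 (hA.acc a ha) Set.univ Filter.univ_mem
  obtain ⟨n, hn⟩ := Function.ne_iff.1 hba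
  exact ⟨n, b, hb.2, a, ha, hn⟩

lemma Perfect.exists_apply_stem {A : Set Cantor} (hA : Perfect A) (hne : A.Nonempty) (e : Bool) :
    ∃ c ∈ A, c (stem A) = e := by
  obtain ⟨a, ha, b, hb, hab⟩ :
      stem A ∈ {n | ∃ a ∈ A, ∃ b ∈ A, a n ≠ b n} := Nat.sInf_mem (hA.exists_ne_apply hne)
  by_cases h : a (stem A) = e
  · exact ⟨a, ha, h⟩
  · refine ⟨b, hb, ?_⟩
    revert hab h
    cases a (stem A) <;> cases b (stem A) <;> cases e <;> simp

lemma isClopen_apply_eq (n : ℕ) (e : Bool) : IsClopen {c : Cantor | c n = e} :=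
  (isClopen_discrete {e}).preimage (f := fun c : Cantor => c n) (continuous_apply n)

lemma isOpen_apply_eq (n : ℕ) (e : Bool) : IsOpen {c : Cantor | c n = e} :=
  (isClopen_apply_eq n e).isOpen

namespace IPe
variable {ζ : Set I} {hζ : IsLowerSet ζ} {X : Set (↥ζ → Cantor)}

lemma segOpen_subset (h : IPe ζ hζ X) {i : I} (hi : i ∈ ζ) {G : Set Cantor} (hG : IsOpen G) :
    SegOpen hζ X hi fun x => fiber hζ X hi x ⊆ G := by
  have hcomp : IsCompact (X ∩ {x | x ⟨i, hi⟩ ∈ Gᶜ}) :=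
    (h.isClosed.inter (hG.isClosed_compl.preimage (continuous_apply _))).isCompact
  refine ⟨_, (hcomp.image (continuous_restrictFn (seg_subset hζ hi))).isClosed.isOpen_compl,
    fun x hx => ?_⟩
  constructor
  · rintro hs ⟨y, ⟨hy, hyG⟩, hyx⟩
    exact hyG (hs ⟨y, hy, hyx, rfl⟩)
  · rintro hs _ ⟨y, hy, hyx, rfl⟩
    by_contra hyG
    exact hs ⟨y, ⟨hy, hyG⟩, hyx⟩

lemma segOpen_stem_eq (h : IPe ζ hζ X) {i : I} (hi : i ∈ ζ) (n : ℕ) :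
    SegOpen hζ X hi fun x => stem (fiber hζ X hi x) = n := by
  have hmeet := fun (k : ℕ) (e : Bool) => h.segOpen hi (isOpen_apply_eq k e)
  have hsub := fun (k : ℕ) (e : Bool) => h.segOpen_subset hi (isOpen_apply_eq k e)
  refine (((hmeet n true).and (hmeet n false)).and
    (SegOpen.forall_lt (fun k => SegOpen.exists' (hsub k)) n)).congr fun x hx => ?_
  set A := fiber hζ X hi x with hA
  have hsplit : ∀ k, (∃ a ∈ A, ∃ b ∈ A, a k ≠ b k) ↔
      (A ∩ {c | c k = true}).Nonempty ∧ (A ∩ {c | c k = false}).Nonempty := by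
    intro k
    constructor
    · rintro ⟨a, ha, b, hb, hab⟩
      cases hak : a k
      · exact ⟨⟨b, hb, by simpa [hak] using hab.symm⟩, ⟨a, ha, hak⟩⟩
      · exact ⟨⟨a, ha, hak⟩, ⟨b, hb, by simpa [hak] using hab.symm⟩⟩
    · rintro ⟨⟨a, ha, ha'⟩, ⟨b, hb, hb'⟩⟩
      exact ⟨a, ha, b, hb, by simp_all⟩
  have hnsplit : ∀ k, (∃ e, A ⊆ {c | c k = e}) ↔ ¬ ∃ a ∈ A, ∃ b ∈ A, a k ≠ b k := by
    intro k
    constructor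
    · rintro ⟨e, he⟩ ⟨a, ha, b, hb, hab⟩
      exact hab ((he ha).trans (he hb).symm)
    · intro hk
      push Not at hk
      exact ⟨x ⟨i, hi⟩ k, fun a ha => hk a ha _ (self_mem_fiber hζ hi hx)⟩
  have hne : {n | ∃ a ∈ A, ∃ b ∈ A, a n ≠ b n}.Nonempty :=
    (h.perfect_fiber hi hx).exists_ne_apply ⟨_, self_mem_fiber hζ hi hx⟩
  simp only [← hsplit, hnsplit]
  constructor
  · rintro rfl
    exact ⟨Nat.sInf_mem hne, fun k hk => Nat.notMem_of_lt_sInf hk⟩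
  · rintro ⟨hn, hlt⟩
    refine le_antisymm (Nat.sInf_le hn) ?_
    by_contra hcon
    exact hlt _ (not_le.1 hcon) (Nat.sInf_mem hne)

lemma exists_mem_spl_agree (h : IPe ζ hζ X) {i : I} (hi : i ∈ ζ) (e : Bool)
    {x : ↥ζ → Cantor} (hx : x ∈ X) :
    ∃ y ∈ Spl hζ X hi e, Agree {k | ¬ i ≤ k} y x := by
  obtain ⟨c, hc, hce⟩ := (h.perfect_fiber hi hx).exists_apply_stem
    ⟨_, self_mem_fiber hζ hi hx⟩ e
  obtain ⟨v, hv, hvx, rfl⟩ := mem_fiber.1 hc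
  obtain ⟨w, hw, hwv, hwx⟩ := h.amalgamates (segLe i) {k | ¬ i ≤ k} (isLowerSet_segLe i)
    (fun a b hba ha hb => ha (hb.trans hba)) v hv x hx
    (hvx.mono fun k hk => lt_of_le_not_ge hk.1 hk.2)
  refine ⟨w, mem_Spl.2 ⟨hw, ?_⟩, hwx⟩
  rw [hwv ⟨i, hi⟩ (mem_segLe_self i),
    fiber_congr hζ X hi ((hwv.mono (seg_subset_segLe i)).trans hvx), hce]

lemma mem_spl_of_agree {i : I} {hi : i ∈ ζ} {e : Bool} {x y : ↥ζ → Cantor} {η : Set I}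
    (hη : IsLowerSet η) (hiη : i ∈ η) (hx : x ∈ X) (hy : y ∈ Spl hζ X hi e) (hxy : Agree η x y) :
    x ∈ Spl hζ X hi e := by
  refine mem_Spl.2 ⟨hx, ?_⟩
  rw [hxy ⟨i, hi⟩ hiη, fiber_congr hζ X hi (hxy.mono (seg_subset hη hiη))]
  exact (mem_Spl.1 hy).2

lemma fiber_spl_self {i : I} {hi : i ∈ ζ} {e : Bool} {x : ↥ζ → Cantor} :
    fiber hζ (Spl hζ X hi e) hi x =
      {c | c (stem (fiber hζ X hi x)) = e} ∩ fiber hζ X hi x := by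
  ext c
  simp only [mem_fiber, Set.mem_inter_iff, Set.mem_ofPred_eq]
  constructor
  · rintro ⟨y, hy, hyx, rfl⟩
    rw [← fiber_congr hζ X hi hyx]
    exact ⟨(mem_Spl.1 hy).2, y, hy.1, hyx, rfl⟩
  · rintro ⟨hc, y, hy, hyx, rfl⟩
    rw [← fiber_congr hζ X hi hyx] at hc
    exact ⟨y, mem_Spl.2 ⟨hy, hc⟩, hyx, rfl⟩

lemma fiber_spl_of_ne (h : IPe ζ hζ X) {i j : I} {hi : i ∈ ζ} (hj : j ∈ ζ) (hij : j ≠ i)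
    {e : Bool} {x : ↥ζ → Cantor} (hx : x ∈ Spl hζ X hi e) :
    fiber hζ (Spl hζ X hi e) hj x = fiber hζ X hj x := by
  ext c
  simp only [mem_fiber]
  constructor
  · rintro ⟨y, hy, hyx, rfl⟩
    exact ⟨y, hy.1, hyx, rfl⟩
  · rintro ⟨y, hy, hyx, rfl⟩
    by_cases hlt : i < j
    · exact ⟨y, mem_spl_of_agree (fun _ _ hba ha => lt_of_le_of_lt hba ha) hlt hy hx hyx,
        hyx, rfl⟩
    · have hnle : ¬ i ≤ j := fun hle => hlt (lt_of_le_of_ne hle hij.symm)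
      obtain ⟨w, hw, hwy⟩ := h.exists_mem_spl_agree hi e hy
      exact ⟨w, hw, (hwy.mono fun k hk hik => hnle (hik.trans (le_of_lt hk))).trans hyx,
        hwy _ hnle⟩

lemma isClosed_spl (h : IPe ζ hζ X) {i : I} (hi : i ∈ ζ) (e : Bool) :
    IsClosed (Spl hζ X hi e) := by
  choose U hU hstem using h.segOpen_stem_eq hi
  have hO : IsOpen (⋃ n, {x : ↥ζ → Cantor | restrictFn (seg_subset hζ hi) x ∈ U n} ∩
      {x | x ⟨i, hi⟩ n = !e}) :=
    isOpen_iUnion fun n => ((hU n).preimage (continuous_restrictFn _)).inter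
      ((isOpen_apply_eq n (!e)).preimage (f := fun x : ↥ζ → Cantor => x ⟨i, hi⟩)
        (continuous_apply _))
  convert h.isClosed.inter hO.isClosed_compl using 1
  ext x
  rw [mem_Spl]
  refine and_congr_right fun hx => ?_
  simp only [Set.mem_compl_iff, Set.mem_iUnion, Set.mem_inter_iff, Set.mem_ofPred_eq,
    ← hstem _ x hx, exists_eq_left']
  cases e <;> simp

lemma spl (h : IPe ζ hζ X) {i : I} (hi : i ∈ ζ) (e : Bool) : IPe ζ hζ (Spl hζ X hi e) := by
  refine (ipe_iff hζ _).2 ⟨⟨h.isClosed_spl hi e, ?_⟩, fun j hj x hx => ?_, fun j hj G hG => ?_, ?_⟩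
  · obtain ⟨x, hx⟩ := h.1.2
    obtain ⟨y, hy, -⟩ := h.exists_mem_spl_agree hi e hx
    exact ⟨y, hy⟩
  · by_cases hji : j = i
    · subst hji
      rw [fiber_spl_self]
      have hp := h.perfect_fiber hi hx.1
      exact ⟨(isClopen_apply_eq _ e).isClosed.inter hp.closed,
        hp.acc.open_inter (isOpen_apply_eq _ e)⟩
    · rw [h.fiber_spl_of_ne hj hji hx]
      exact h.perfect_fiber hj hx.1
  · by_cases hji : j = i
    · subst hji
      obtain ⟨U, hU, hUx⟩ := SegOpen.exists' fun n =>
        (h.segOpen_stem_eq hi n).and (h.segOpen hi (hG.inter (isOpen_apply_eq n e)))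
      refine ⟨U, hU, fun x hx => ?_⟩
      rw [← hUx x hx.1]
      beta_reduce
      rw [exists_eq_left', fiber_spl_self]
      congr! 1
      ext c
      simp only [Set.mem_inter_iff]
      tauto
    · obtain ⟨U, hU, hUx⟩ := h.segOpen hj hG
      refine ⟨U, hU, fun x hx => ?_⟩
      rw [← hUx x hx.1]
      beta_reduce
      rw [h.fiber_spl_of_ne hj hji hx]
  · intro η θ hη hθ x hx y hy hxy
    obtain ⟨w, hw, hwx, hwy⟩ := h.amalgamates η θ hη hθ x hx.1 y hy.1 hxy
    by_cases hiη : i ∈ η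
    · exact ⟨w, mem_spl_of_agree hη hiη hw hx hwx, hwx, hwy⟩
    by_cases hiθ : i ∈ θ
    · exact ⟨w, mem_spl_of_agree hθ hiθ hw hy hwy, hwx, hwy⟩
    obtain ⟨v, hv, hvw⟩ := h.exists_mem_spl_agree hi e hw
    exact ⟨v, hv, (hvw.mono fun k hk hik => hiη (hη hik hk)).trans hwx,
      (hvw.mono fun k hk hik => hiθ (hθ hik hk)).trans hwy⟩

lemma xPhi (h : IPe ζ hζ X) (Φ : ℕ → I) (hΦ : ∀ n, Φ n ∈ ζ) (m : ℕ) (u : Fin m → Bool) :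
    IPe ζ hζ (XPhi hζ Φ hΦ X m u) := by
  induction m with
  | zero => exact h
  | succ m ih => exact (ih _).spl _ _

lemma nonempty_iInter_xPhi (h : IPe ζ hζ X) (Φ : ℕ → I) (hΦ : ∀ n, Φ n ∈ ζ) (a : ℕ → Bool) :
    (⋂ m : ℕ, XPhi hζ Φ hΦ X m (fun k => a k.1)).Nonempty :=
  IsCompact.nonempty_iInter_of_sequence_nonempty_isCompact_isClosed _ (fun _ _ hx => hx.1)
    (fun m => (h.xPhi Φ hΦ m _).1.2) h.isClosed.isCompact
    (fun m => (h.xPhi Φ hΦ m _).isClosed)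

end IPe

lemma fiber_subset_fiber {ζ ξ : Set I} (hζ : IsLowerSet ζ) (hξ : IsLowerSet ξ)
    {A B : Set (↥ζ → Cantor)} (hA : Amalgamates A) {i : I} (hi : i ∈ ζ) (hiξ : i ∉ ξ)
    {v : ↥ζ → Cantor} (hv : v ∈ A) (hAB : ∀ u ∈ A, Agree ξ u v → u ∈ B) :
    fiber hζ A hi v ⊆ fiber hζ B hi v := by
  rintro c hc
  obtain ⟨u, hu, huv, rfl⟩ := mem_fiber.1 hc
  obtain ⟨w, hw, hwv, hwu⟩ := hA ξ (segLe i) hξ (isLowerSet_segLe i) v hv u hu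
    (huv.symm.mono fun k hk => lt_of_le_of_ne hk.2 fun hki => hiξ (hki ▸ hk.1))
  exact mem_fiber.2 ⟨w, hAB w hw hwv, (hwu.mono (seg_subset_segLe i)).trans huv,
    hwu ⟨i, hi⟩ (mem_segLe_self i)⟩

lemma fiber_resSet {ζ ξ : Set I} (hζ : IsLowerSet ζ) (hξ : IsLowerSet ξ) (hsub : ξ ⊆ ζ)
    (X : Set (↥ζ → Cantor)) {i : I} (hi : i ∈ ξ) (x : ↥ζ → Cantor) :
    fiber hξ (resSet hsub X) hi (restrictFn hsub x) = fiber hζ X (hsub hi) x := by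
  ext c
  constructor
  · rintro ⟨_, ⟨y, hy, rfl⟩, hyx, rfl⟩
    exact ⟨y, hy, hyx, rfl⟩
  · rintro ⟨y, hy, hyx, rfl⟩
    exact ⟨_, ⟨y, hy, rfl⟩, hyx, rfl⟩

lemma resSet_spl_of_mem {ζ ξ : Set I} (hζ : IsLowerSet ζ) (hξ : IsLowerSet ξ) (hsub : ξ ⊆ ζ)
    (X : Set (↥ζ → Cantor)) {i : I} (hiζ : i ∈ ζ) (hi : i ∈ ξ) (e : Bool) :
    resSet hsub (Spl hζ X hiζ e) = Spl hξ (resSet hsub X) hi e := by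
  ext z
  constructor
  · rintro ⟨x, hx, rfl⟩
    refine mem_Spl.2 ⟨⟨x, hx.1, rfl⟩, ?_⟩
    rw [fiber_resSet hζ]
    exact (mem_Spl.1 hx).2
  · intro hz
    obtain ⟨⟨x, hx, rfl⟩, hz⟩ := mem_Spl.1 hz
    rw [fiber_resSet hζ] at hz
    exact ⟨x, mem_Spl.2 ⟨hx, hz⟩, rfl⟩

lemma IPe.resSet_spl_of_notMem {ζ ξ : Set I} {hζ : IsLowerSet ζ} (hξ : IsLowerSet ξ)
    (hsub : ξ ⊆ ζ) {X : Set (↥ζ → Cantor)} (h : IPe ζ hζ X) {i : I} (hi : i ∈ ζ) (hiξ : i ∉ ξ)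
    (e : Bool) : resSet hsub (Spl hζ X hi e) = resSet hsub X := by
  refine Set.Subset.antisymm (Set.image_mono fun x hx => hx.1) ?_
  rintro _ ⟨x, hx, rfl⟩
  obtain ⟨y, hy, hyx⟩ := h.exists_mem_spl_agree hi e hx
  exact ⟨y, hy, (restrictFn_eq_iff hsub).2 (hyx.mono fun k hk hik => hiξ (hξ hik hk))⟩

lemma IPe.inter_resPre {ζ ξ : Set I} {hζ : IsLowerSet ζ} {hξ : IsLowerSet ξ} (hsub : ξ ⊆ ζ)
    {X : Set (↥ζ → Cantor)} {Y : Set (↥ξ → Cantor)} (hX : IPe ζ hζ X) (hY : IPe ξ hξ Y)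
    (hYsub : Y ⊆ resSet hsub X) : IPe ζ hζ (X ∩ resPre hsub Y) := by
  have hres := resSet_inter_resPre hsub hYsub
  have hfib : ∀ {i : I} (hi : i ∈ ξ) (x : ↥ζ → Cantor),
      fiber hζ (X ∩ resPre hsub Y) (hsub hi) x = fiber hξ Y hi (restrictFn hsub x) := by
    intro i hi x
    rw [← fiber_resSet hζ hξ hsub, hres]
  have hfib' : ∀ {i : I} (hi : i ∈ ζ) (_ : i ∉ ξ) (x : ↥ζ → Cantor) (_ : x ∈ X ∩ resPre hsub Y),
      fiber hζ (X ∩ resPre hsub Y) hi x = fiber hζ X hi x := by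
    intro i hi hiξ x hx
    refine Set.Subset.antisymm ?_ (fiber_subset_fiber hζ hξ hX.amalgamates hi hiξ hx.1
      fun u hu hux => ⟨hu, mem_resPre_of_agree hsub hx.2 hux⟩)
    rintro _ ⟨u, hu, hux, rfl⟩
    exact ⟨u, hu.1, hux, rfl⟩
  refine (ipe_iff hζ _).2 ⟨⟨hX.isClosed.inter (hY.isClosed.preimage (continuous_restrictFn hsub)),
    ?_⟩, fun i hi x hx => ?_, fun i hi G hG => ?_, ?_⟩
  · obtain ⟨y, hy⟩ := hY.1.2
    obtain ⟨x, hx, rfl⟩ := hYsub hy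
    exact ⟨x, hx, hy⟩
  · by_cases hiξ : i ∈ ξ
    · rw [hfib hiξ]
      exact hY.perfect_fiber hiξ hx.2
    · rw [hfib' hi hiξ x hx]
      exact hX.perfect_fiber hi hx.1
  · by_cases hiξ : i ∈ ξ
    · obtain ⟨U, hU, hUx⟩ := hY.segOpen hiξ hG
      refine ⟨U, hU, fun x hx => ?_⟩
      beta_reduce
      rw [hfib hiξ]
      exact hUx _ hx.2
    · obtain ⟨U, hU, hUx⟩ := hX.segOpen hi hG
      refine ⟨U, hU, fun x hx => ?_⟩
      beta_reduce
      rw [hfib' hi hiξ x hx]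
      exact hUx _ hx.1
  · intro η θ hη hθ x hx y hy hxy
    obtain ⟨_, hwY, hwx, hwy⟩ := hY.amalgamates η θ hη hθ _ hx.2 _ hy.2
      fun j hj => hxy ⟨j.1, hsub j.2⟩ hj
    obtain ⟨w, hw, rfl⟩ := hYsub hwY
    obtain ⟨v, hv, hvx, hvy⟩ := hX.amalgamates η θ hη hθ x hx.1 y hy.1 hxy
    obtain ⟨u, hu, huw, huv⟩ := hX.amalgamates ξ (η ∪ θ) hξ (hη.union hθ) w hw v hv (by
      rintro j ⟨hjξ, hj | hj⟩
      · exact (hwx ⟨j.1, hjξ⟩ hj).trans (hvx j hj).symm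
      · exact (hwy ⟨j.1, hjξ⟩ hj).trans (hvy j hj).symm)
    exact ⟨u, ⟨hu, mem_resPre_of_agree hsub hwY huw⟩,
      (huv.mono Set.subset_union_left).trans hvx, (huv.mono Set.subset_union_right).trans hvy⟩

lemma Spl_congr {ζ : Set I} (hζ : IsLowerSet ζ) (X : Set (↥ζ → Cantor)) {i j : I} (hi : i ∈ ζ)
    (hj : j ∈ ζ) {e f : Bool} (hij : i = j) (hef : e = f) : Spl hζ X hi e = Spl hζ X hj f := by
  subst hij hef
  rfl

lemma IPe.agree_of_shrinkable_resSet {ζ ξ : Set I} {hζ : IsLowerSet ζ} {hξ : IsLowerSet ξ}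
    (hsub : ξ ⊆ ζ) {X : Set (↥ζ → Cantor)} (hX : IPe ζ hζ X)
    (hS : Shrinkable hξ (resSet hsub X)) {Φ : ℕ → I} (hΦ : Admissible ζ Φ) {a : ℕ → Bool}
    {x y : ↥ζ → Cantor} (hx : ∀ m : ℕ, x ∈ XPhi hζ Φ hΦ.1 X m (fun k => a k.1))
    (hy : ∀ m : ℕ, y ∈ XPhi hζ Φ hΦ.1 X m (fun k => a k.1)) : Agree ξ x y := by
  classical
  rcases Set.eq_empty_or_nonempty ξ with rfl | ⟨i₀, hi₀⟩
  · exact fun _ hj => absurd hj (Set.notMem_empty _)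
  let p : ℕ → Prop := fun n => Φ n ∈ ξ
  have hinf : (Set.ofPred p).Infinite := Set.infinite_of_forall_exists_gt fun N => by
    obtain ⟨n, hn, hni⟩ := hΦ.2 i₀ (hsub hi₀) (N + 1)
    exact ⟨n, show Φ n ∈ ξ from hni ▸ hi₀, hn⟩
  have hΨ : Admissible ξ fun k => Φ (Nat.nth p k) := by
    refine ⟨fun k => Nat.nth_mem_of_infinite hinf k, fun i hi N => ?_⟩
    obtain ⟨n, hn, hni⟩ := hΦ.2 i (hsub hi) (Nat.nth p N)
    have hpn : p n := show Φ n ∈ ξ from hni ▸ hi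
    refine ⟨Nat.count p n, ?_, ?_⟩
    · rw [← Nat.count_nth_of_infinite hinf N]
      exact Nat.count_monotone p hn
    · exact (congrArg Φ (Nat.nth_count hpn)).trans hni
  have key : ∀ m : ℕ, resSet hsub (XPhi hζ Φ hΦ.1 X m (fun k => a k.1)) =
      XPhi hξ _ hΨ.1 (resSet hsub X) (Nat.count p m) (fun k => a (Nat.nth p k.1)) := by
    intro m
    induction m with
    | zero => rw [Nat.count_zero]; rfl
    | succ m ih =>
      by_cases hm : p m
      · rw [Nat.count_succ, if_pos hm]
        refine (resSet_spl_of_mem hζ hξ hsub _ (hΦ.1 m) hm (a m)).trans ?_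
        simp only [Fin.val_castSucc]
        rw [ih]
        exact Spl_congr hξ _ _ _ (congrArg Φ (Nat.nth_count hm).symm)
          (congrArg a (Nat.nth_count hm).symm)
      · rw [Nat.count_succ, if_neg hm, add_zero, ← ih]
        exact (hX.xPhi Φ hΦ.1 m _).resSet_spl_of_notMem hξ hsub (hΦ.1 m) hm (a m)
  obtain ⟨z, hz⟩ := hS _ hΨ fun k => a (Nat.nth p k)
  have hmem : ∀ v : ↥ζ → Cantor, (∀ m : ℕ, v ∈ XPhi hζ Φ hΦ.1 X m (fun k => a k.1)) →
      restrictFn hsub v = z := by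
    intro v hv
    rw [← Set.mem_singleton_iff, ← hz, Set.mem_iInter]
    intro k
    have hk := Set.mem_image_of_mem (restrictFn hsub) (hv (Nat.nth p k))
    rwa [← resSet, key, Nat.count_nth_of_infinite hinf] at hk
  exact (restrictFn_eq_iff hsub).1 ((hmem x hx).trans (hmem y hy).symm)

lemma exists_xPhi_bits {ζ : Set I} (hζ : IsLowerSet ζ) (Φ : ℕ → I) (hΦ : ∀ n, Φ n ∈ ζ)
    (X : Set (↥ζ → Cantor)) (F : Set (↥ζ → Cantor) → ℕ → Bool) :
    ∃ b : ℕ → Bool, ∀ m, b m = F (XPhi hζ Φ hΦ X m (fun k => b k.1)) m := by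
  let T : ℕ → Set (↥ζ → Cantor) := fun m =>
    Nat.rec X (fun n A => Spl hζ A (hΦ n) (F A n)) m
  have hT : ∀ m, XPhi hζ Φ hΦ X m (fun k => F (T k.1) k.1) = T m := by
    intro m
    induction m with
    | zero => rfl
    | succ m ih => exact congrArg (fun A => Spl hζ A (hΦ m) (F (T m) m)) ih
  exact ⟨fun m => F (T m) m, fun m => by rw [hT]⟩

lemma eq_of_mem_xPhi_inter_resPre {ζ ξ : Set I} {hζ : IsLowerSet ζ} (hξ : IsLowerSet ξ)
    (hsub : ξ ⊆ ζ) {X : Set (↥ζ → Cantor)} {Y : Set (↥ξ → Cantor)} (hX : Pe ζ hζ X)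
    (hZ : IPe ζ hζ (X ∩ resPre hsub Y)) {Φ : ℕ → I} (hΦ : Admissible ζ Φ) {a : ℕ → Bool}
    {x y : ↥ζ → Cantor}
    (hx : ∀ m : ℕ, x ∈ XPhi hζ Φ hΦ.1 (X ∩ resPre hsub Y) m (fun k => a k.1))
    (hy : ∀ m : ℕ, y ∈ XPhi hζ Φ hΦ.1 (X ∩ resPre hsub Y) m (fun k => a k.1))
    (hyx : Agree ξ y x) : y = x := by
  classical
  obtain ⟨b, hb⟩ := exists_xPhi_bits hζ Φ hΦ.1 X fun A m =>
    if Φ m ∈ ξ then x ⟨Φ m, hΦ.1 m⟩ (stem (fiber hζ A (hΦ.1 m) x)) else a m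
  have key : ∀ (m : ℕ) (v : ↥ζ → Cantor), Agree ξ v x →
      (v ∈ XPhi hζ Φ hΦ.1 (X ∩ resPre hsub Y) m (fun k => a k.1) ↔
        v ∈ XPhi hζ Φ hΦ.1 X m (fun k => b k.1)) := by
    intro m
    induction m with
    | zero => exact fun v hv => ⟨fun h => h.1, fun h => ⟨h, mem_resPre_of_agree hsub (hx 0).2 hv⟩⟩
    | succ m ih =>
      intro v hv
      have hbm := hb m
      have hxm : x ∈ Spl hζ (XPhi hζ Φ hΦ.1 (X ∩ resPre hsub Y) m (fun k => a k.1))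
        (hΦ.1 m) (a m) := hx (m + 1)
      have hZm := (hZ.xPhi Φ hΦ.1 m (fun k => a k.1)).amalgamates
      have hXm := (hX.1.xPhi Φ hΦ.1 m (fun k => b k.1)).amalgamates
      change v ∈ Spl hζ (XPhi hζ Φ hΦ.1 (X ∩ resPre hsub Y) m (fun k => a k.1))
        (hΦ.1 m) (a m) ↔ v ∈ Spl hζ (XPhi hζ Φ hΦ.1 X m (fun k => b k.1)) (hΦ.1 m) (b m)
      by_cases hm : Φ m ∈ ξ
      · rw [if_pos hm] at hbm
        have hxb : x ∈ Spl hζ (XPhi hζ Φ hΦ.1 X m (fun k => b k.1)) (hΦ.1 m) (b m) :=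
          mem_Spl.2 ⟨(ih x (Agree.refl _ _)).1 hxm.1, hbm.symm⟩
        exact ⟨fun h => IPe.mem_spl_of_agree hξ hm ((ih v hv).1 h.1) hxb hv,
          fun h => IPe.mem_spl_of_agree hξ hm ((ih v hv).2 h.1) hxm hv⟩
      · rw [if_neg hm] at hbm
        rw [mem_Spl, mem_Spl, ih v hv, hbm]
        refine and_congr_right fun hvm => ?_
        rw [Set.Subset.antisymm
          (fiber_subset_fiber hζ hξ hZm (hΦ.1 m) hm ((ih v hv).2 hvm)
            fun u hu huv => (ih u (huv.trans hv)).1 hu)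
          (fiber_subset_fiber hζ hξ hXm (hΦ.1 m) hm hvm
            fun u hu huv => (ih u (huv.trans hv)).2 hu)]
  obtain ⟨z, hz⟩ := hX.2 Φ hΦ b
  have hmem : ∀ v : ↥ζ → Cantor, Agree ξ v x →
      (∀ m : ℕ, v ∈ XPhi hζ Φ hΦ.1 (X ∩ resPre hsub Y) m (fun k => a k.1)) → v = z := by
    intro v hv hvm
    rw [← Set.mem_singleton_iff, ← hz, Set.mem_iInter]
    exact fun m => (key m v hv).1 (hvm m)
  exact (hmem y hyx hy).trans (hmem x (Agree.refl _ _) hx).symm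

end

theorem stmt6 (I : Type) [PartialOrder I] [Countable I]
    (ξ ζ : Set I) (hξ : IsLowerSet ξ) (hζ : IsLowerSet ζ) (hsub : ξ ⊆ ζ)
    (X : Set (↥ζ → Cantor)) (hX : Pe ζ hζ X)
    (Y : Set (↥ξ → Cantor)) (hY : Pe ξ hξ Y) (hYsub : Y ⊆ resSet hsub X) :
    Pe ζ hζ (X ∩ resPre hsub Y) := by
  have hZ := hX.1.inter_resPre hsub hY.1 hYsub
  refine ⟨hZ, fun Φ hΦ a => ?_⟩
  obtain ⟨x, hx⟩ := hZ.nonempty_iInter_xPhi Φ hΦ.1 a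
  refine ⟨x, Set.Subset.antisymm (fun y hy => ?_) (Set.singleton_subset_iff.2 hx)⟩
  rw [Set.mem_iInter] at hx hy
  have hS : Shrinkable hξ (resSet hsub (X ∩ resPre hsub Y)) := by
    rw [resSet_inter_resPre hsub hYsub]
    exact hY.2
  exact eq_of_mem_xPhi_inter_resPre hξ hsub hX hZ hΦ hx hy
    (hZ.agree_of_shrinkable_resSet hsub hS hΦ hy hx)
end
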